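/- arXiv:2208.03756 — 4 statements merged into one kernel-verified Lean document; each statement's English description precedes it below -/
import Mathlib

section
/- Let m ≥ 1 be an integer and a ∈ ℂ with a ≠ 0, and let f : ℂ → ℂ be a polynomial function of the form f(z) = z + a·z^(m+1) + z^(m+2)·g(z) for some polynomial g. Suppose a sequence (z_k) in ℂ satisfies z_{k+1} = f(z_k) for all k, z_k ≠ 0 for all k, and z_k → 0 as k → ∞. Then there exists v ∈ ℂ with m·a·v^m = −1 such that (k^(1/m))·z_k → v as k → ∞, where k^(1/m) denotes the positive real m-th root of k. -/
open Filter Topology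

/-- A complex sequence whose `m`-th powers converge to a nonzero limit and whose consecutive
ratios tend to `1` converges to an `m`-th root of that limit. -/
theorem exists_tendsto_of_tendsto_pow_of_tendsto_ratio {m : ℕ} (hm : m ≠ 0) {L : ℂ} (hL : L ≠ 0)
    {y : ℕ → ℂ} (hpow : Tendsto (fun k => y k ^ m) atTop (𝓝 L))
    (hratio : Tendsto (fun k => y (k + 1) / y k) atTop (𝓝 1)) :
    ∃ v : ℂ, v ^ m = L ∧ Tendsto y atTop (𝓝 v) := by
  let s : ℕ → ℂ := fun k => (y k ^ m / L) ^ ((m : ℂ)⁻¹)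
  have hs : Tendsto s atTop (𝓝 1) := by
    have h1 : Tendsto (fun k => y k ^ m / L) atTop (𝓝 1) := by
      simpa [hL] using hpow.div_const L
    have h2 := h1.cpow (tendsto_const_nhds (x := ((m : ℂ)⁻¹))) (by simp)
    simpa using h2
  have hspow (k : ℕ) : s k ^ m = y k ^ m / L := Complex.cpow_nat_inv_pow _ hm
  have hy : ∀ᶠ k in atTop, y k ≠ 0 := by
    filter_upwards [hpow.eventually_ne hL] with k hk h0
    exact hk (by simp [h0, hm])
  have hs0 : ∀ᶠ k in atTop, s k ≠ 0 := hs.eventually_ne one_ne_zero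
  let p : ℕ → ℂ := fun k => y k / s k
  have hp : ∀ᶠ k in atTop, p k ^ m = L := by
    filter_upwards [hy] with k hk
    have : y k ^ m ≠ 0 := pow_ne_zero _ hk
    simp only [p, div_pow, hspow]
    field_simp
  have hpratio : Tendsto (fun k => p (k + 1) / p k) atTop (𝓝 1) := by
    have h := hratio.div ((hs.comp (tendsto_add_atTop_nat 1)).div hs one_ne_zero) (by simp)
    simp only [div_one] at h
    refine h.congr fun k => ?_
    simp only [p, Pi.div_apply, Function.comp_apply]
    rw [div_div_div_comm]
  have hfin : {x : ℂ | x ^ m = 1 ∧ x ≠ 1}.Finite := by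
    refine Set.Finite.subset (s := {x : ℂ | x ∈ Polynomial.nthRoots m (1 : ℂ)})
      (Multiset.finite_toSet _) fun x hx => ?_
    exact (Polynomial.mem_nthRoots (Nat.pos_of_ne_zero hm)).2 hx.1
  have hnear : {x : ℂ | x ^ m = 1 ∧ x ≠ 1}ᶜ ∈ 𝓝 (1 : ℂ) :=
    hfin.isClosed.isOpen_compl.mem_nhds (by simp)
  have hstep : ∀ᶠ k in atTop, p (k + 1) = p k := by
    filter_upwards [hpratio.eventually_mem hnear, hp, (tendsto_add_atTop_nat 1).eventually hp]
      with k hk h1 h2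
    have h0 : p k ≠ 0 := by
      intro h
      rw [h, zero_pow hm] at h1
      exact hL h1.symm
    by_contra hne
    refine hk ⟨?_, fun h => hne ((div_eq_one_iff_eq h0).1 h)⟩
    rw [div_pow, h1, h2, div_self hL]
  obtain ⟨N, hN⟩ := eventually_atTop.1 (hstep.and hp)
  have hconst : ∀ k ≥ N, p k = p N := fun k hk =>
    Nat.le_induction rfl (fun n hn ih => (hN n hn).1.trans ih) k hk
  refine ⟨p N, (hN N le_rfl).2, ?_⟩
  have hlim : Tendsto (fun k => p N * s k) atTop (𝓝 (p N)) := by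
    simpa using hs.const_mul (p N)
  refine hlim.congr' ?_
  filter_upwards [eventually_ge_atTop N, hs0] with k hk h0
  rw [← hconst k hk]
  exact div_mul_cancel₀ _ h0

/-- If the increments of a complex sequence converge to `c`, then `w k / k` converges to `c`. -/
theorem tendsto_div_natCast_of_tendsto_sub {w : ℕ → ℂ} {c : ℂ}
    (h : Tendsto (fun k => w (k + 1) - w k) atTop (𝓝 c)) :
    Tendsto (fun k : ℕ => w k / k) atTop (𝓝 c) := by
  have h1 := h.cesaro_smul
  have h2 : Tendsto (fun k : ℕ => w 0 / (k : ℂ)) atTop (𝓝 0) :=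
    tendsto_const_div_atTop_nhds_zero_nat _
  have h3 := h1.add h2
  rw [add_zero] at h3
  refine h3.congr fun k => ?_
  rw [Finset.sum_range_sub, Complex.real_smul]
  push_cast
  ring

/-- Along a sequence `t → 0` of nonzero numbers, `((1 + t) ^ m)⁻¹ - 1` is equivalent to
`-m * t`. -/
theorem tendsto_inv_one_add_pow_sub_one_div (m : ℕ) {t : ℕ → ℂ}
    (ht : Tendsto t atTop (𝓝 0)) (ht0 : ∀ᶠ k in atTop, t k ≠ 0) :
    Tendsto (fun k => (((1 + t k) ^ m)⁻¹ - 1) / t k) atTop (𝓝 (-m)) := by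
  have hd : HasDerivAt (fun x : ℂ => ((1 + x) ^ m)⁻¹) (-m) 0 := by
    have h : HasDerivAt (fun x : ℂ => ((1 + x) ^ m)⁻¹) _ 0 :=
      (((hasDerivAt_id (0 : ℂ)).const_add 1).pow m).inv (by simp)
    simpa using h
  have h := (hasDerivAt_iff_tendsto_slope.1 hd).comp
    (tendsto_nhdsWithin_iff.2 ⟨ht, ht0⟩)
  refine h.congr fun k => ?_
  simp [slope_def_field]

/-- Every orbit of `f(z) = z + a·z^(m+1) + (higher terms)` that converges to zero
nontrivially is asymptotic to `v / k^(1/m)` for one of the `m` attraction vectors `v`,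
i.e. `k^(1/m) · z_k → v` with `m·a·v^m = -1`. -/
theorem orbit_converging_nontrivially_asymptotic_attraction_vector
    (m : ℕ) (hm : 1 ≤ m) (a : ℂ) (ha : a ≠ 0)
    (f : ℂ → ℂ) (g : Polynomial ℂ)
    (hf : ∀ z : ℂ, f z = z + a * z ^ (m + 1) + z ^ (m + 2) * g.eval z)
    (z : ℕ → ℂ)
    (horbit : ∀ k : ℕ, z (k + 1) = f (z k))
    (hnz : ∀ k : ℕ, z k ≠ 0)
    (hlim : Tendsto z atTop (𝓝 0)) :
    ∃ v : ℂ, (m : ℂ) * a * v ^ m = -1 ∧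
      Tendsto (fun k : ℕ => (((k : ℝ) ^ ((1 : ℝ) / (m : ℝ)) : ℝ) : ℂ) * z k)
        atTop (𝓝 v) := by
  have hm0 : m ≠ 0 := Nat.one_le_iff_ne_zero.1 hm
  have hmC : (m : ℂ) ≠ 0 := Nat.cast_ne_zero.2 hm0
  let u : ℕ → ℂ := fun k => a + z k * g.eval (z k)
  have hu : Tendsto u atTop (𝓝 a) := by
    have h := (hlim.mul ((g.continuous.tendsto 0).comp hlim)).const_add a
    simpa using h
  let t : ℕ → ℂ := fun k => z k ^ m * u k
  have ht : Tendsto t atTop (𝓝 0) := by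
    simpa [hm0] using (hlim.pow m).mul hu
  have ht0 : ∀ᶠ k in atTop, t k ≠ 0 := by
    filter_upwards [hu.eventually_ne ha] with k hk
    exact mul_ne_zero (pow_ne_zero _ (hnz k)) hk
  have hz (k : ℕ) : z (k + 1) = z k * (1 + t k) := by
    rw [horbit, hf]
    simp only [t, u]
    ring
  have hinc : Tendsto (fun k => (z (k + 1) ^ m)⁻¹ - (z k ^ m)⁻¹) atTop (𝓝 (-m * a)) := by
    refine ((tendsto_inv_one_add_pow_sub_one_div m ht ht0).mul hu).congr' ?_
    filter_upwards [hu.eventually_ne ha] with k hk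
    have h1 : z k ^ m ≠ 0 := pow_ne_zero _ (hnz k)
    rw [hz, mul_pow, mul_inv]
    change (((1 + t k) ^ m)⁻¹ - 1) / (z k ^ m * u k) * u k = _
    field_simp
  have hL : -(m : ℂ) * a ≠ 0 := mul_ne_zero (neg_ne_zero.2 hmC) ha
  have hpow : Tendsto
      (fun k : ℕ => ((((k : ℝ) ^ ((1 : ℝ) / (m : ℝ)) : ℝ) : ℂ) * z k) ^ m)
      atTop (𝓝 (-(m : ℂ) * a)⁻¹) := by
    have h := (tendsto_div_natCast_of_tendsto_sub (w := fun k => (z k ^ m)⁻¹) hinc).inv₀ hL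
    refine h.congr fun k => ?_
    rw [mul_pow, ← Complex.ofReal_pow, one_div, Real.rpow_inv_natCast_pow k.cast_nonneg hm0]
    simp [div_eq_mul_inv]
  have hratio : Tendsto
      (fun k : ℕ => ((((k + 1 : ℕ) : ℝ) ^ ((1 : ℝ) / (m : ℝ)) : ℝ) : ℂ) * z (k + 1) /
        ((((k : ℝ) ^ ((1 : ℝ) / (m : ℝ)) : ℝ) : ℂ) * z k)) atTop (𝓝 1) := by
    have h1 : Tendsto (fun k : ℕ => ((k + 1 : ℕ) : ℝ) / (k : ℝ)) atTop (𝓝 1) := by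
      have h := (tendsto_natCast_div_add_atTop (1 : ℝ)).inv₀ one_ne_zero
      simpa using h
    have h2 : Tendsto (fun k : ℕ => (((k + 1 : ℕ) : ℝ) / (k : ℝ)) ^ ((1 : ℝ) / m))
        atTop (𝓝 1) := by
      simpa using h1.rpow_const (p := (1 : ℝ) / m) (Or.inl one_ne_zero)
    have h3 := ((Complex.continuous_ofReal.tendsto 1).comp h2).mul (ht.const_add 1)
    simp only [Complex.ofReal_one, add_zero, mul_one] at h3
    refine h3.congr fun k => ?_
    simp only [Function.comp_apply]
    rw [Real.div_rpow (Nat.cast_nonneg _) (Nat.cast_nonneg _), hz, Complex.ofReal_div,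
      mul_div_mul_comm, mul_div_cancel_left₀ _ (hnz k)]
  obtain ⟨v, hv, hvlim⟩ :=
    exists_tendsto_of_tendsto_pow_of_tendsto_ratio hm0 (inv_ne_zero hL) hpow hratio
  refine ⟨v, ?_, hvlim⟩
  rw [hv]
  field_simp
end

section
/- Let f : ℂ → ℂ be defined by f(z) = z + z². Then the sequence k ↦ k · f^[k](−1/2) converges to −1 as k → ∞; that is, the orbit of q = −1/2 satisfies f^[k](q) ∼ −1/k. -/
open Filter Topology

/-- A positive null sequence with `x (k + 1) = x k - x k ^ 2` satisfies `x k ∼ 1 / k`. -/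
theorem tendsto_natCast_mul_of_succ_eq_sub_sq {x : ℕ → ℝ} (hpos : ∀ k, 0 < x k)
    (hx : ∀ k, x (k + 1) = x k - x k ^ 2) (hlim : Tendsto x atTop (𝓝 0)) :
    Tendsto (fun k : ℕ => (k : ℝ) * x k) atTop (𝓝 1) := by
  have hlt : ∀ k, 0 < 1 - x k := fun k => by
    have h := hpos (k + 1)
    rw [hx, show x k - x k ^ 2 = x k * (1 - x k) by ring] at h
    exact (mul_pos_iff_of_pos_left (hpos k)).1 h
  have hdiff : ∀ k, (x (k + 1))⁻¹ - (x k)⁻¹ = (1 - x k)⁻¹ := fun k => by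
    have h₁ := (hpos k).ne'
    have h₂ := (hlt k).ne'
    rw [hx, show x k - x k ^ 2 = x k * (1 - x k) by ring]
    field_simp
    ring
  have hstep : Tendsto (fun k => (x (k + 1))⁻¹ - (x k)⁻¹) atTop (𝓝 1) := by
    simp only [hdiff]
    simpa using (hlim.const_sub 1).inv₀ (by norm_num)
  have hmean := hstep.cesaro
  simp only [Finset.sum_range_sub (fun k => (x k)⁻¹)] at hmean
  have hinit : Tendsto (fun n : ℕ => (n : ℝ)⁻¹ * (x 0)⁻¹) atTop (𝓝 0) := by
    simpa using (tendsto_inv_atTop_nhds_zero_nat (𝕜 := ℝ)).mul_const (x 0)⁻¹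
  have hrecip : Tendsto (fun n : ℕ => (n : ℝ)⁻¹ * (x n)⁻¹) atTop (𝓝 1) := by
    simpa [mul_sub] using hmean.add hinit
  simpa [mul_comm] using hrecip.inv₀ one_ne_zero

/-- The orbit of `1 / 2` under `x ↦ x - x ^ 2` is positive and bounded by `1 / (k + 2)`. -/
theorem pos_and_le_one_div_of_succ_eq_sub_sq {x : ℕ → ℝ} (h₀ : x 0 = 1 / 2)
    (hx : ∀ k, x (k + 1) = x k - x k ^ 2) (k : ℕ) : 0 < x k ∧ x k ≤ 1 / (k + 2) := by
  induction k with
  | zero => norm_num [h₀]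
  | succ k ih =>
    obtain ⟨hpos, hle⟩ := ih
    have hk : (0 : ℝ) ≤ k := k.cast_nonneg
    have hhalf : 1 / ((k : ℝ) + 2) ≤ 1 / 2 := one_div_le_one_div_of_le two_pos (by linarith)
    have hbound : 1 / ((k : ℝ) + 2) - (1 / ((k : ℝ) + 2)) ^ 2 ≤ 1 / ((k : ℝ) + 1 + 2) := by
      rw [← sub_nonneg, show 1 / ((k : ℝ) + 1 + 2) -
        (1 / ((k : ℝ) + 2) - (1 / ((k : ℝ) + 2)) ^ 2) = 1 / (((k : ℝ) + 3) * (k + 2) ^ 2) by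
          field_simp
          ring]
      positivity
    rw [hx]
    push_cast
    constructor <;> nlinarith

/-- For `f(z) = z + z²`, the orbit of `q = -1/2` satisfies `f^[k](q) ∼ -1/k`,
i.e. `k · f^[k](-1/2) → -1` as `k → ∞`. -/
theorem orbit_of_neg_half_asymptotic
    (f : ℂ → ℂ) (hf : ∀ z : ℂ, f z = z + z ^ 2) :
    Tendsto (fun k : ℕ => (k : ℂ) * f^[k] (-1/2)) atTop (𝓝 (-1)) := by
  set x : ℕ → ℝ := fun k => (fun t : ℝ => t - t ^ 2)^[k] (1 / 2) with hxdef
  have hx : ∀ k, x (k + 1) = x k - x k ^ 2 := fun k => by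
    simp only [hxdef, Function.iterate_succ_apply']
  have hbounds := pos_and_le_one_div_of_succ_eq_sub_sq (x := x) rfl hx
  have hlim : Tendsto x atTop (𝓝 0) := by
    refine squeeze_zero (fun k => (hbounds k).1.le) (fun k => (hbounds k).2.trans ?_)
      (tendsto_one_div_add_atTop_nhds_zero_nat (𝕜 := ℝ))
    exact one_div_le_one_div_of_le (by positivity) (by linarith)
  have horbit : ∀ k, f^[k] (-1/2) = -(x k : ℂ) := fun k => by
    induction k with
    | zero => norm_num [hxdef]
    | succ k ih =>
      rw [Function.iterate_succ_apply', ih, hf, hx]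
      push_cast
      ring
  have hreal := tendsto_natCast_mul_of_succ_eq_sub_sq (fun k => (hbounds k).1) hx hlim
  have hcomplex := ((Complex.continuous_ofReal.tendsto 1).comp hreal).neg
  simpa [horbit, Function.comp_def] using hcomplex
end

section
/- Let m ≥ 1 be an integer, a ∈ ℂ with a ≠ 0, and f : ℂ → ℂ defined by f(z) = z + a·z^(m+1). Then the function z ↦ 1/(m·a·z^m) − 1/(m·a·(f z)^m) tends to 1 as z → 0 with z ≠ 0 (limit along the punctured neighborhood filter at 0). Equivalently, in the coordinate ω = −1/(m·a·z^m) the map f becomes ω ↦ ω + 1 + o(1). -/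
open Filter Topology

/-- Approximate Fatou coordinate: for `f(z) = z + a·z^(m+1)`, the quantity
`1/(m·a·z^m) − 1/(m·a·(f z)^m)` tends to `1` as `z → 0` with `z ≠ 0`; i.e. in the
coordinate `ω = −1/(m·a·z^m)` the map becomes `ω ↦ ω + 1 + o(1)`. -/
theorem fatou_coordinate_translation
    (m : ℕ) (hm : 1 ≤ m) (a : ℂ) (ha : a ≠ 0)
    (f : ℂ → ℂ) (hf : ∀ z : ℂ, f z = z + a * z ^ (m + 1)) :
    Tendsto (fun z : ℂ => 1 / ((m : ℂ) * a * z ^ m) - 1 / ((m : ℂ) * a * (f z) ^ m))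
      (𝓝[≠] 0) (𝓝 1) := by
  have hm0 : (m : ℂ) ≠ 0 := by exact_mod_cast (by omega : m ≠ 0)
  set u : ℂ → ℂ := fun z => 1 + a * z ^ m with hu
  have hu_cont : Continuous u := by fun_prop
  have hu_zero : u 0 = 1 := by simp [hu, show m ≠ 0 by omega]
  have h_lim : Tendsto (fun z => (∑ k ∈ Finset.range m, u z ^ k) / (m * u z ^ m))
      (𝓝[≠] 0) (𝓝 1) := by
    have h : ContinuousAt (fun z => (∑ k ∈ Finset.range m, u z ^ k) / (m * u z ^ m)) 0 :=
      ContinuousAt.div (by fun_prop) (by fun_prop) (by simp [hu_zero, hm0])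
    have h_tendsto := h.tendsto
    simp only [hu_zero, one_pow, Finset.sum_const, Finset.card_range, nsmul_eq_mul, mul_one,
      div_self hm0] at h_tendsto
    exact h_tendsto.mono_left nhdsWithin_le_nhds
  refine h_lim.congr' ?_
  have hu_ne : ∀ᶠ z in 𝓝[≠] (0 : ℂ), u z ≠ 0 :=
    (hu_cont.continuousAt.eventually_ne (by simp [hu_zero])).filter_mono nhdsWithin_le_nhds
  filter_upwards [self_mem_nhdsWithin, hu_ne] with z hz huz
  have hz0 : z ^ m ≠ 0 := pow_ne_zero m hz
  have hum : u z ^ m ≠ 0 := pow_ne_zero m huz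
  have hfz : f z ^ m = z ^ m * u z ^ m := by
    rw [hf, ← mul_pow]
    simp only [hu]
    ring
  have h_geom : (∑ k ∈ Finset.range m, u z ^ k) * (a * z ^ m) = u z ^ m - 1 := by
    rw [← geom_sum_mul (u z) m]
    simp [hu]
  rw [hfz]
  field_simp
  linear_combination h_geom
end

section
/- For every constant C > 0 there exists δ > 0 such that for all points z and w of the upper half-plane ℍ with Re z > 1/2, Im z < δ, and Re w ≤ 0, the hyperbolic distance satisfies dist(z, w) ≥ C. -/
/-- Case 2 estimate: for every `C > 0` there is `δ > 0` such that any point of the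
upper half-plane with real part `> 1/2` and imaginary part `< δ` has hyperbolic
distance at least `C` from every point of the closed left half-plane. -/
theorem hyperbolic_dist_ge_of_near_axis_far_left
    (C : ℝ) (hC : 0 < C) :
    ∃ δ : ℝ, 0 < δ ∧ ∀ z w : UpperHalfPlane,
      1 / 2 < z.re → z.im < δ → w.re ≤ 0 → C ≤ dist z w := by
  refine ⟨1 / (2 * Real.exp C), by positivity, fun z w hz hδ hw => ?_⟩
  by_contra! hlt
  have hre : 1 / 2 < dist (w : ℂ) z := calc
    1 / 2 < z.re - w.re := by linarith
    _ = ((z : ℂ) - w).re := rfl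
    _ ≤ ‖(z : ℂ) - w‖ := Complex.re_le_norm _
    _ = dist (w : ℂ) z := by rw [dist_comm, dist_eq_norm]
  have hexp : Real.exp (dist w z) ≤ Real.exp C :=
    Real.exp_le_exp.2 (by rw [dist_comm]; exact hlt.le)
  have him : z.im * (2 * Real.exp C) < 1 := (lt_div_iff₀ (by positivity)).1 hδ
  nlinarith [UpperHalfPlane.dist_coe_le w z, mul_le_mul_of_nonneg_left hexp z.im_pos.le, z.im_pos]
end
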